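/- Let ω be a weight on ℝ₊ with ω ∈ B_p(0) and 1 < p < ∞. Then D_0^{1,p}(ℝ₊,ω) = R^0_{p,ω}(0) if and only if ω ∉ B_p(∞). -/

import Mathlib

open MeasureTheory Set Filter Topology
open scoped NNReal ENNReal

noncomputable section

/-- A weight on `ℝ₊ = (0,∞)`: continuous and positive there. -/
def IsWeight (ω : ℝ → ℝ) : Prop :=
  ContinuousOn ω (Set.Ioi 0) ∧ ∀ t : ℝ, 0 < t → 0 < ω t

/-- Membership of the pair `(u, u')` in the weighted Dirichlet space
`D^{1,p}(ℝ₊, ω)`: `u'` is locally integrable on `(0,∞)`, `u` is locally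
absolutely continuous with derivative `u'`, and `∫_0^∞ |u'|^p ω < ∞`. -/
def MemD (p : ℝ) (ω u u' : ℝ → ℝ) : Prop :=
  (∀ a b : ℝ, 0 < a → a < b → IntegrableOn u' (Set.Ioc a b)) ∧
  (∀ a b : ℝ, 0 < a → a < b → u b - u a = ∫ τ in a..b, u' τ) ∧
  IntegrableOn (fun t => |u' t| ^ p * ω t) (Set.Ioi 0)

/-- `‖u'‖_{L^p(ℝ₊, ω)} = (∫_0^∞ |u'(t)|^p ω(t) dt)^{1/p}`. -/
def dNorm (p : ℝ) (ω u' : ℝ → ℝ) : ℝ :=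
  (∫ t in Set.Ioi (0:ℝ), |u' t| ^ p * ω t) ^ (1 / p)

/-- The norm `‖u‖^{(a)} = |u(a)| + ‖u'‖_{L^p(ℝ₊, ω)}`. -/
def aNorm (p : ℝ) (ω : ℝ → ℝ) (a : ℝ) (u u' : ℝ → ℝ) : ℝ :=
  |u a| + dNorm p ω u'

/-- `ω ∈ B_p(0)`: `∫_0^1 ω(t)^{-1/(p-1)} dt < ∞`. -/
def Bp0 (p : ℝ) (ω : ℝ → ℝ) : Prop :=
  IntegrableOn (fun t => ω t ^ (-1 / (p - 1))) (Set.Ioc (0:ℝ) 1)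

/-- `ω ∈ B_p(∞)`: `∫_1^∞ ω(t)^{-1/(p-1)} dt < ∞`. -/
def BpInf (p : ℝ) (ω : ℝ → ℝ) : Prop :=
  IntegrableOn (fun t => ω t ^ (-1 / (p - 1))) (Set.Ioi (1:ℝ))

/-- `Ω^0_ω(t) = (∫_0^t ω(τ)^{-1/(p-1)} dτ)^{1-1/p}`. -/
def Omega0 (p : ℝ) (ω : ℝ → ℝ) (t : ℝ) : ℝ :=
  (∫ τ in Set.Ioc (0:ℝ) t, ω τ ^ (-1 / (p - 1))) ^ (1 - 1 / p)

/-- `Ω^∞_ω(t) = (∫_t^∞ ω(τ)^{-1/(p-1)} dτ)^{1-1/p}`. -/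
def OmegaInf (p : ℝ) (ω : ℝ → ℝ) (t : ℝ) : ℝ :=
  (∫ τ in Set.Ioi t, ω τ ^ (-1 / (p - 1))) ^ (1 - 1 / p)

/-- `R^0_{p,ω}(c)`: elements of `D^{1,p}(ℝ₊,ω)` with
`u(t) = c + ∫_0^t u'(τ) dτ` for every `t > 0`. -/
def MemR0 (p : ℝ) (ω : ℝ → ℝ) (c : ℝ) (u u' : ℝ → ℝ) : Prop :=
  MemD p ω u u' ∧ ∀ t : ℝ, 0 < t →
    IntegrableOn u' (Set.Ioc 0 t) ∧ u t = c + ∫ τ in Set.Ioc (0:ℝ) t, u' τ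

/-- `R^∞_{p,ω}(c)`: elements of `D^{1,p}(ℝ₊,ω)` with
`u(t) = c - ∫_t^∞ u'(τ) dτ` for every `t > 0`. -/
def MemRInf (p : ℝ) (ω : ℝ → ℝ) (c : ℝ) (u u' : ℝ → ℝ) : Prop :=
  MemD p ω u u' ∧ ∀ t : ℝ, 0 < t →
    IntegrableOn u' (Set.Ioi t) ∧ u t = c - ∫ τ in Set.Ioi t, u' τ

/-- `D_0^{1,p}(ℝ₊,ω)`: elements of `D^{1,p}(ℝ₊,ω)` approximable by smooth
compactly supported functions on `(0,∞)`, with derivatives converging in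
`L^p(ℝ₊,ω)` and locally uniform convergence on compact subsets of `(0,∞)`. -/
def MemD0 (p : ℝ) (ω u u' : ℝ → ℝ) : Prop :=
  MemD p ω u u' ∧
  ∃ φ : ℕ → ℝ → ℝ,
    (∀ n, ContDiff ℝ (⊤ : ℕ∞) (φ n) ∧ HasCompactSupport (φ n) ∧ tsupport (φ n) ⊆ Set.Ioi 0) ∧
    Tendsto (fun n => ∫ t in Set.Ioi (0:ℝ), |deriv (φ n) t - u' t| ^ p * ω t)
      atTop (𝓝 0) ∧
    (∀ K : Set ℝ, K ⊆ Set.Ioi 0 → IsCompact K →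
      TendstoUniformlyOn (fun n => φ n) u atTop K)


/-- `L^p` approximation by smooth functions that preserves the integral and nearly preserves
the support. -/
theorem exists_contDiff_eLpNorm_sub_le_integral_eq {P : ℝ≥0∞} (hP : P ≠ ⊤) (hP1 : 1 ≤ P)
    {a b r : ℝ} (hab : a < b) (hr : 0 < r) {F : ℝ → ℝ} (hF : MemLp F P volume)
    (hF0 : ∀ t, t ∉ Icc a b → F t = 0) {ε : ℝ} (hε : 0 < ε) :
    ∃ g : ℝ → ℝ, ContDiff ℝ (⊤ : ℕ∞) g ∧ (∀ t, t ∉ Icc (a - r) (b + r) → g t = 0) ∧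
      ∫ t, g t = ∫ t, F t ∧ eLpNorm (F - g) P volume ≤ ENNReal.ofReal ε := by
  let χ : ContDiffBump ((a + b) / 2) :=
    ⟨(b - a) / 2, (b - a) / 2 + r, by linarith, by linarith⟩
  have hball : Metric.closedBall ((a + b) / 2) χ.rOut = Icc (a - r) (b + r) := by
    rw [Real.closedBall_eq_Icc]; congr 1 <;> simp only [χ] <;> ring
  have hball' : Metric.closedBall ((a + b) / 2) χ.rIn = Icc a b := by
    rw [Real.closedBall_eq_Icc]; congr 1 <;> simp only [χ] <;> ring
  set K := Icc (a - r) (b + r) with hK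
  have hχ0 : ∀ t, t ∉ K → χ t = 0 := fun t ht ↦
    image_eq_zero_of_notMem_tsupport (by rwa [χ.tsupport_eq, hball])
  set h : ℝ → ℝ := χ.normed volume with hh
  have hh0 : ∀ t, t ∉ K → h t = 0 := fun t ht ↦
    image_eq_zero_of_notMem_tsupport (by rwa [hh, χ.tsupport_normed_eq, hball])
  have hhc : ContDiff ℝ (⊤ : ℕ∞) h := χ.contDiff_normed
  have hhs : HasCompactSupport h := χ.hasCompactSupport_normed
  have hhP : MemLp h P volume := hhc.continuous.memLp_of_hasCompactSupport hhs
  set C : ℝ≥0∞ := (volume.restrict K) univ ^ (1 / (1 : ℝ≥0∞).toReal - 1 / P.toReal) with hC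
  have hCtop : C ≠ ⊤ := by
    refine ENNReal.rpow_ne_top_of_nonneg ?_ (by simp [hK])
    have : 1 ≤ P.toReal := by
      rw [← ENNReal.toReal_one]; exact ENNReal.toReal_mono hP hP1
    have := inv_le_one_of_one_le₀ this
    simpa using this
  have hk_int : ∀ k : ℝ → ℝ, MemLp k P volume → (∀ t, t ∉ K → k t = 0) →
      Integrable k ∧ ‖∫ t, k t‖ₑ ≤ eLpNorm k P volume * C := by
    intro k hk hk0
    have hkr := hk.restrict K
    refine ⟨(integrableOn_iff_integrable_of_support_subset (s := K) ?_).1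
      (hkr.integrable hP1), ?_⟩
    · intro t ht; by_contra h'; exact ht (hk0 t h')
    · rw [← setIntegral_eq_integral_of_forall_compl_eq_zero (s := K) hk0]
      calc _ ≤ ∫⁻ t in K, ‖k t‖ₑ := enorm_integral_le_lintegral_enorm _
        _ = eLpNorm k 1 (volume.restrict K) := eLpNorm_one_eq_lintegral_enorm.symm
        _ ≤ eLpNorm k P (volume.restrict K) * C :=
          eLpNorm_le_eLpNorm_mul_rpow_measure_univ hP1 hkr.aestronglyMeasurable
        _ ≤ _ := by gcongr; exact Measure.restrict_le_self
  set D : ℝ≥0∞ := 1 + C * eLpNorm h P volume with hD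
  have hDtop : D ≠ ⊤ := by simp [hD, ENNReal.mul_eq_top, hCtop, hhP.eLpNorm_ne_top]
  have hD1 : 1 ≤ D := by simp [hD]
  have hDpos : 0 < D.toReal := ENNReal.toReal_pos (by positivity) hDtop
  obtain ⟨g₀, hg₀s, hg₀c, hg₀⟩ := hF.exist_eLpNorm_sub_le hP hP1 (ε := ε / D.toReal) (by positivity)
  have hχg : ContDiff ℝ (⊤ : ℕ∞) (fun t ↦ χ t * g₀ t) := χ.contDiff.mul hg₀c
  have hχgP : MemLp (fun t ↦ χ t * g₀ t) P volume :=
    hχg.continuous.memLp_of_hasCompactSupport hg₀s.mul_left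
  have hsub : MemLp (F - fun t ↦ χ t * g₀ t) P volume := hF.sub hχgP
  have hKab : Icc a b ⊆ K := Icc_subset_Icc (by linarith) (by linarith)
  have hχg0 : ∀ t, t ∉ K → χ t * g₀ t = 0 := fun t ht ↦ by rw [hχ0 t ht, zero_mul]
  have hF0' : ∀ t, t ∉ K → F t = 0 := fun t ht ↦ hF0 t fun h' ↦ ht (hKab h')
  have hsub_le : eLpNorm (F - fun t ↦ χ t * g₀ t) P volume ≤ ENNReal.ofReal (ε / D.toReal) := by
    refine (eLpNorm_mono fun t ↦ ?_).trans hg₀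
    simp only [Pi.sub_apply]
    by_cases ht : t ∈ Icc a b
    · rw [χ.one_of_mem_closedBall (by rwa [hball']), one_mul]
    · rw [hF0 t ht, zero_sub, zero_sub, norm_neg, norm_neg, norm_mul]
      refine mul_le_of_le_one_left (norm_nonneg _) ?_
      rw [Real.norm_of_nonneg χ.nonneg]; exact χ.le_one
  obtain ⟨hsubi, hsubn⟩ := hk_int _ hsub fun t ht ↦ by simp [hF0' t ht, hχg0 t ht]
  obtain ⟨hχi, -⟩ := hk_int _ hχgP hχg0
  obtain ⟨hFi, -⟩ := hk_int _ hF hF0'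
  set c : ℝ := ∫ t, (F - fun t ↦ χ t * g₀ t) t with hc
  have hhi : Integrable h := hhc.continuous.integrable_of_hasCompactSupport hhs
  refine ⟨fun t ↦ χ t * g₀ t + c * h t, hχg.add (contDiff_const.mul hhc), fun t ht ↦ ?_, ?_, ?_⟩
  · simp only [hχg0 t ht, hh0 t ht, mul_zero, add_zero]
  · rw [integral_add hχi (hhi.const_mul c), integral_const_mul, hh, χ.integral_normed, mul_one, hc]
    simp only [Pi.sub_apply]
    rw [integral_sub hFi hχi]; ring
  · have : (F - fun t ↦ χ t * g₀ t + c * h t) = (F - fun t ↦ χ t * g₀ t) - c • h := by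
      ext t; simp [smul_eq_mul]; ring
    rw [this]
    calc _ ≤ eLpNorm (F - fun t ↦ χ t * g₀ t) P volume + eLpNorm (c • h) P volume :=
          eLpNorm_sub_le hsub.aestronglyMeasurable
            (hhP.aestronglyMeasurable.const_smul c) hP1
      _ ≤ eLpNorm (F - fun t ↦ χ t * g₀ t) P volume +
          eLpNorm (F - fun t ↦ χ t * g₀ t) P volume * C * eLpNorm h P volume := by
          rw [eLpNorm_const_smul]; gcongr
      _ = eLpNorm (F - fun t ↦ χ t * g₀ t) P volume * D := by rw [hD]; ring
      _ ≤ ENNReal.ofReal (ε / D.toReal) * D := by gcongr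
      _ = ENNReal.ofReal (ε / D.toReal) * ENNReal.ofReal D.toReal := by
          rw [ENNReal.ofReal_toReal hDtop]
      _ = ENNReal.ofReal ε := by
          rw [← ENNReal.ofReal_mul (by positivity), div_mul_cancel₀ _ (ne_of_gt hDpos)]

/-- A smooth function supported in `[a, b] ⊆ (0, ∞)` of zero integral is the derivative of a
test function on `(0, ∞)`. -/
theorem exists_contDiff_deriv_eq {a b : ℝ} (ha : 0 < a) {g : ℝ → ℝ}
    (hg : ContDiff ℝ (⊤ : ℕ∞) g) (hg0 : ∀ t, t ∉ Icc a b → g t = 0) (hg_int : ∫ t, g t = 0) :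
    ∃ φ : ℝ → ℝ, ContDiff ℝ (⊤ : ℕ∞) φ ∧ HasCompactSupport φ ∧ tsupport φ ⊆ Ioi 0 ∧
      deriv φ = g := by
  have hd : deriv (fun t ↦ ∫ s in (0 : ℝ)..t, g s) = g :=
    funext fun t ↦ hg.continuous.deriv_integral g 0 t
  have hsupp : Function.support (fun t ↦ ∫ s in (0 : ℝ)..t, g s) ⊆ Icc a b := by
    refine Function.support_subset_iff'.2 fun t ht ↦ ?_
    rcases lt_or_ge t a with hta | hta
    · have : ∀ s ∈ uIcc 0 t, g s = 0 := fun s hs ↦ hg0 s fun h ↦ by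
        rcases mem_uIcc.1 hs with h' | h' <;> linarith [h.1, h'.1, h'.2]
      simpa using intervalIntegral.integral_congr (μ := volume) this
    · have htb : b < t := by by_contra! h; exact ht ⟨hta, h⟩
      rw [intervalIntegral.integral_of_le (ha.le.trans hta)]
      refine (setIntegral_eq_integral_of_forall_compl_eq_zero fun s hs ↦ hg0 s fun h ↦ hs ?_).trans
        hg_int
      exact ⟨ha.trans_le h.1, h.2.trans htb.le⟩
  refine ⟨_, contDiff_infty_iff_deriv.2
    ⟨intervalIntegral.differentiable_integral_of_continuous hg.continuous, by rwa [hd]⟩,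
    .of_support_subset_isCompact isCompact_Icc hsupp,
    (closure_minimal hsupp isClosed_Icc).trans fun t ht ↦ ha.trans_le ht.1, hd⟩

theorem setIntegral_deriv_eq_of_tsupport_subset {φ : ℝ → ℝ} (hφ : ContDiff ℝ (⊤ : ℕ∞) φ)
    (h0 : tsupport φ ⊆ Ioi 0) {t : ℝ} (ht : 0 ≤ t) : ∫ s in Ioc 0 t, deriv φ s = φ t := by
  have hc : Continuous (deriv φ) := hφ.continuous_deriv (by simp)
  rw [← intervalIntegral.integral_of_le ht, intervalIntegral.integral_deriv_eq_sub
    (fun x _ ↦ (hφ.differentiable (by simp)).differentiableAt) (hc.intervalIntegrable _ _),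
    image_eq_zero_of_notMem_tsupport fun h ↦ lt_irrefl (0 : ℝ) (h0 h), sub_zero]

theorem integral_deriv_eq_zero_of_hasCompactSupport {φ : ℝ → ℝ} (hφ : ContDiff ℝ (⊤ : ℕ∞) φ)
    (hs : HasCompactSupport φ) : ∫ s, deriv φ s = 0 :=
  integral_of_hasDerivAt_of_tendsto (f := φ) (m := 0) (n := 0)
    (fun x ↦ (hφ.differentiable (by simp)).differentiableAt.hasDerivAt)
    ((hφ.continuous_deriv (by simp)).integrable_of_hasCompactSupport hs.deriv)
    (hs.is_zero_at_infty.mono_left atBot_le_cocompact)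
    (hs.is_zero_at_infty.mono_left atTop_le_cocompact) |>.trans (sub_zero 0)

/-- The function `f ω^{1/p}`, whose `L^p` norm is the weighted norm of `f`. -/
def weighted (p : ℝ) (ω f : ℝ → ℝ) : ℝ → ℝ := fun t ↦ f t * ω t ^ (1 / p)

theorem norm_weighted_rpow {p : ℝ} {ω : ℝ → ℝ} (hp : 1 < p) (hω : IsWeight ω) (f : ℝ → ℝ)
    {t : ℝ} (ht : 0 < t) : ‖weighted p ω f t‖ ^ p = |f t| ^ p * ω t := by
  have h := hω.2 t ht
  rw [weighted, norm_mul, Real.norm_of_nonneg (by positivity : 0 ≤ ω t ^ (1 / p)),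
    Real.mul_rpow (norm_nonneg _) (by positivity), ← Real.rpow_mul h.le,
    one_div_mul_cancel (by positivity), Real.rpow_one, Real.norm_eq_abs]

theorem IsWeight.aestronglyMeasurable_rpow {ω : ℝ → ℝ} (hω : IsWeight ω) (r : ℝ) :
    AEStronglyMeasurable (fun t ↦ ω t ^ r) (volume.restrict (Ioi 0)) :=
  (hω.1.rpow_const fun t ht ↦ Or.inl (hω.2 t ht).ne').aestronglyMeasurable measurableSet_Ioi

theorem aestronglyMeasurable_weighted {p : ℝ} {ω f : ℝ → ℝ} (hω : IsWeight ω)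
    (hf : AEStronglyMeasurable f (volume.restrict (Ioi 0))) :
    AEStronglyMeasurable (weighted p ω f) (volume.restrict (Ioi 0)) :=
  hf.mul (hω.aestronglyMeasurable_rpow _)

theorem memLp_weighted_iff {p : ℝ} {ω f : ℝ → ℝ} (hp : 1 < p) (hω : IsWeight ω)
    (hf : AEStronglyMeasurable f (volume.restrict (Ioi 0))) :
    MemLp (weighted p ω f) (ENNReal.ofReal p) (volume.restrict (Ioi 0)) ↔
      IntegrableOn (fun t ↦ |f t| ^ p * ω t) (Ioi 0) := by
  have hp0 : 0 < p := by linarith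
  rw [← integrable_norm_rpow_iff (aestronglyMeasurable_weighted hω hf) (by simpa using hp0)
    ENNReal.ofReal_ne_top, ENNReal.toReal_ofReal hp0.le]
  exact integrableOn_congr_fun (fun t ht ↦ norm_weighted_rpow hp hω f ht) measurableSet_Ioi

theorem eLpNorm_weighted {p : ℝ} {ω f : ℝ → ℝ} (hp : 1 < p) (hω : IsWeight ω)
    (hf : MemLp (weighted p ω f) (ENNReal.ofReal p) (volume.restrict (Ioi 0))) :
    eLpNorm (weighted p ω f) (ENNReal.ofReal p) (volume.restrict (Ioi 0)) =
      ENNReal.ofReal ((∫ t in Ioi 0, |f t| ^ p * ω t) ^ (1 / p)) := by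
  have hp0 : 0 < p := by linarith
  rw [hf.eLpNorm_eq_integral_rpow_norm (by simpa using hp0) ENNReal.ofReal_ne_top,
    ENNReal.toReal_ofReal hp0.le, one_div,
    setIntegral_congr_fun measurableSet_Ioi fun t ht ↦ norm_weighted_rpow hp hω f ht]

/-- Hölder's inequality for the pair of weights `ω` and `ω^{-1/(p-1)}`. -/
theorem integrableOn_and_setIntegral_abs_le {p : ℝ} {ω f : ℝ → ℝ} (hp : 1 < p) (hω : IsWeight ω)
    (hf : AEStronglyMeasurable f (volume.restrict (Ioi 0)))
    (hfp : IntegrableOn (fun t ↦ |f t| ^ p * ω t) (Ioi 0)) {s : Set ℝ} (hs : MeasurableSet s)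
    (hs0 : s ⊆ Ioi 0) (hv : IntegrableOn (fun t ↦ ω t ^ (-1 / (p - 1))) s) :
    IntegrableOn f s ∧ ∫ t in s, |f t| ≤
      (∫ t in Ioi 0, |f t| ^ p * ω t) ^ (1 / p) *
        (∫ t in s, ω t ^ (-1 / (p - 1))) ^ (1 - 1 / p) := by
  have hp0 : 0 < p := by linarith
  have hp1 : p - 1 ≠ 0 := by linarith
  have hpq := Real.HolderConjugate.conjExponent hp
  have hq0 := hpq.symm.pos
  have hq : p.conjExponent = p / (p - 1) := rfl
  have hF := ((memLp_weighted_iff hp hω hf).2 hfp).mono_measure (Measure.restrict_mono_set _ hs0)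
  have hpow : ∀ t ∈ s, ‖ω t ^ (-1 / p)‖ ^ p.conjExponent = ω t ^ (-1 / (p - 1)) := by
    intro t ht
    have h := hω.2 t (hs0 ht)
    rw [Real.norm_of_nonneg (by positivity), ← Real.rpow_mul h.le, hq]
    congr 1; field_simp
  have hG : MemLp (fun t ↦ ω t ^ (-1 / p)) (ENNReal.ofReal p.conjExponent)
      (volume.restrict s) := by
    rw [← integrable_norm_rpow_iff
      ((hω.aestronglyMeasurable_rpow _).mono_measure (Measure.restrict_mono_set _ hs0))
      (by simpa using hq0) ENNReal.ofReal_ne_top, ENNReal.toReal_ofReal hq0.le]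
    exact (integrableOn_congr_fun hpow hs).2 hv
  have hmul : ∀ t ∈ s, weighted p ω f t * ω t ^ (-1 / p) = f t := by
    intro t ht
    have h := hω.2 t (hs0 ht)
    rw [weighted, mul_assoc, ← Real.rpow_add h]
    ring_nf; simp
  have := hpq.ennrealOfReal
  refine ⟨(integrableOn_congr_fun hmul hs).1 (hF.integrable_mul hG), ?_⟩
  have key := integral_mul_norm_le_Lp_mul_Lq hpq hF hG
  rw [setIntegral_congr_fun hs hpow, setIntegral_congr_fun hs
    (g := fun t ↦ |f t|) (fun t ht ↦ by
      rw [← norm_mul, hmul t ht, Real.norm_eq_abs]), setIntegral_congr_fun hs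
    (fun t ht ↦ norm_weighted_rpow hp hω f (hs0 ht))] at key
  refine key.trans ?_
  rw [show 1 / p.conjExponent = 1 - 1 / p by rw [hq]; field_simp]
  have hnn : ∀ t ∈ Ioi (0 : ℝ), 0 ≤ |f t| ^ p * ω t := fun t ht ↦
    mul_nonneg (by positivity) (hω.2 t ht).le
  gcongr
  · exact Real.rpow_nonneg (setIntegral_nonneg hs fun t ht ↦ Real.rpow_nonneg
      (hω.2 t (hs0 ht)).le _) _
  · exact setIntegral_nonneg hs fun t ht ↦ hnn t (hs0 ht)
  · exact (ae_restrict_iff' measurableSet_Ioi).2 (.of_forall hnn)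

theorem MemD.aestronglyMeasurable {p : ℝ} {ω u u' : ℝ → ℝ} (h : MemD p ω u u') :
    AEStronglyMeasurable u' (volume.restrict (Ioi 0)) := by
  have : Ioi (0 : ℝ) = ⋃ n : ℕ, Ioc (1 / ((n : ℝ) + 1)) (n + 2) := by
    refine subset_antisymm (fun t ht ↦ ?_) (iUnion_subset fun n t ht ↦ ?_)
    · obtain ⟨n, hn⟩ := exists_nat_one_div_lt (mem_Ioi.1 ht)
      obtain ⟨m, hm⟩ := exists_nat_ge t
      refine mem_iUnion.2 ⟨max n m, ?_, ?_⟩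
      · refine lt_of_le_of_lt ?_ hn
        gcongr; exact le_max_left _ _
      · push_cast; linarith [le_max_right (n : ℝ) m]
    · exact lt_trans (by positivity) ht.1
  rw [this]
  refine .iUnion fun n ↦ (h.1 _ _ (by positivity) ?_).aestronglyMeasurable
  have : 1 / ((n : ℝ) + 1) ≤ 1 := by
    rw [div_le_one (by positivity)]; simp
  have : (0 : ℝ) ≤ n := n.cast_nonneg
  linarith

theorem IsWeight.integrableOn_Icc {ω : ℝ → ℝ} (hω : IsWeight ω) (r : ℝ) {a b : ℝ} (ha : 0 < a) :
    IntegrableOn (fun t ↦ ω t ^ r) (Icc a b) :=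
  ((hω.1.rpow_const fun t ht ↦ Or.inl (hω.2 t ht).ne').mono
    fun _ ht ↦ ha.trans_le ht.1).integrableOn_Icc

theorem Bp0.integrableOn_Ioc {p : ℝ} {ω : ℝ → ℝ} (hB : Bp0 p ω) (hω : IsWeight ω) (t : ℝ) :
    IntegrableOn (fun t ↦ ω t ^ (-1 / (p - 1))) (Ioc 0 t) := by
  refine (hB.union (hω.integrableOn_Icc _ (b := t) one_pos)).mono_set fun s hs ↦ ?_
  rcases le_total s 1 with h | h
  · exact Or.inl ⟨hs.1, h⟩
  · exact Or.inr ⟨h, hs.2⟩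

theorem IsWeight.integrableOn_abs_sub_rpow_mul {p : ℝ} {ω f g : ℝ → ℝ} (hp : 1 < p)
    (hω : IsWeight ω) (hf : AEStronglyMeasurable f (volume.restrict (Ioi 0)))
    (hg : AEStronglyMeasurable g (volume.restrict (Ioi 0)))
    (hfp : IntegrableOn (fun t ↦ |f t| ^ p * ω t) (Ioi 0))
    (hgp : IntegrableOn (fun t ↦ |g t| ^ p * ω t) (Ioi 0)) :
    IntegrableOn (fun t ↦ |f t - g t| ^ p * ω t) (Ioi 0) := by
  refine (memLp_weighted_iff hp hω (hf.sub hg)).1 ?_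
  convert! ((memLp_weighted_iff hp hω hf).2 hfp).sub ((memLp_weighted_iff hp hω hg).2 hgp) using 1
  ext t; simp [weighted, sub_mul]

theorem IsWeight.integrableOn_abs_rpow_mul_of_continuous {p : ℝ} {ω g : ℝ → ℝ} (hp : 1 < p)
    (hω : IsWeight ω) (hg : Continuous g) (hgs : HasCompactSupport g) (hg0 : tsupport g ⊆ Ioi 0) :
    IntegrableOn (fun t ↦ |g t| ^ p * ω t) (Ioi 0) := by
  have hp0 : 0 < p := by linarith
  have hK : IntegrableOn (fun t ↦ |g t| ^ p * ω t) (tsupport g) :=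
    ((hg.abs.rpow_const fun _ ↦ Or.inr hp0.le).continuousOn.mul
      (hω.1.mono hg0)).integrableOn_compact hgs
  refine hK.of_forall_sdiff_eq_zero measurableSet_Ioi fun t ht ↦ ?_
  simp [image_eq_zero_of_notMem_tsupport ht.2, hp0.ne']

theorem weighted_sub (p : ℝ) (ω f g : ℝ → ℝ) :
    weighted p ω (f - g) = weighted p ω f - weighted p ω g := by
  ext t; simp [weighted, sub_mul]

theorem exists_contDiff_eLpNorm_weighted_sub_le {p : ℝ} {ω : ℝ → ℝ} (hp : 1 < p)
    (hω : IsWeight ω) {a b : ℝ} (ha : 0 < a) (hab : a < b) {F : ℝ → ℝ}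
    (hF : MemLp F (ENNReal.ofReal p) volume) (hF0 : ∀ t, t ∉ Icc a b → F t = 0) {ε : ℝ}
    (hε : 0 < ε) :
    ∃ g : ℝ → ℝ, ContDiff ℝ (⊤ : ℕ∞) g ∧ (∀ t, t ∉ Icc (a / 2) (b + a / 2) → g t = 0) ∧
      ∫ t, g t = ∫ t, F t ∧
      eLpNorm (weighted p ω (F - g)) (ENNReal.ofReal p) (volume.restrict (Ioi 0)) ≤
        ENNReal.ofReal ε := by
  obtain ⟨M, hM⟩ := (isCompact_Icc (a := a / 2) (b := b + a / 2)).exists_bound_of_continuousOn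
    (f := fun t ↦ ω t ^ (1 / p)) ((hω.1.rpow_const fun t ht ↦ Or.inl (hω.2 t ht).ne').mono
      fun t ht ↦ (half_pos ha).trans_le ht.1)
  have hM0 : 0 ≤ M := (norm_nonneg _).trans (hM a ⟨by linarith, by linarith⟩)
  obtain ⟨g, hg, hg0, hgi, hgε⟩ := exists_contDiff_eLpNorm_sub_le_integral_eq
    ENNReal.ofReal_ne_top (by simpa using hp.le) hab (half_pos ha) hF hF0
    (ε := ε / (M + 1)) (by positivity)
  rw [sub_half] at hg0
  refine ⟨g, hg, hg0, hgi, ?_⟩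
  have hle : ∀ t, ‖weighted p ω (F - g) t‖ ≤ (M + 1) * ‖(F - g) t‖ := by
    intro t
    rw [weighted, norm_mul, mul_comm]
    by_cases ht : t ∈ Icc (a / 2) (b + a / 2)
    · gcongr; linarith [hM t ht]
    · have : (F - g) t = 0 := by
        rw [Pi.sub_apply, hg0 t ht, hF0 t fun h ↦ ht ⟨by linarith [h.1], by linarith [h.2]⟩,
          sub_zero]
      simp [this]
  calc _ ≤ ENNReal.ofReal (M + 1) *
        eLpNorm (F - g) (ENNReal.ofReal p) (volume.restrict (Ioi 0)) :=
        eLpNorm_le_mul_eLpNorm_of_ae_le_mul (.of_forall hle) _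
    _ ≤ ENNReal.ofReal (M + 1) * ENNReal.ofReal (ε / (M + 1)) := by
        gcongr
        exact (eLpNorm_mono_measure _ Measure.restrict_le_self).trans hgε
    _ = ENNReal.ofReal ε := by
        rw [← ENNReal.ofReal_mul (by positivity), mul_div_cancel₀ _ (by positivity)]

theorem exists_indicator_Icc_eLpNorm_weighted_sub_le {p : ℝ} {ω f : ℝ → ℝ} (hp : 1 < p)
    (hω : IsWeight ω) (hf : AEStronglyMeasurable f (volume.restrict (Ioi 0)))
    (hfp : IntegrableOn (fun t ↦ |f t| ^ p * ω t) (Ioi 0)) {ε : ℝ} (hε : 0 < ε) :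
    ∃ a b : ℝ, 0 < a ∧ a ≤ 1 ∧ 1 ≤ b ∧
      eLpNorm (weighted p ω (f - (Icc a b).indicator f)) (ENNReal.ofReal p)
        (volume.restrict (Ioi 0)) ≤ ENNReal.ofReal ε := by
  have hp0 : 0 < p := by linarith
  let K : ℕ → Set ℝ := fun n ↦ Icc (1 / ((n : ℝ) + 1)) (n + 1)
  let R : ℕ → ℝ → ℝ := fun n ↦ f - (K n).indicator f
  have hR : ∀ n, AEStronglyMeasurable (R n) (volume.restrict (Ioi 0)) := fun n ↦
    hf.sub (hf.indicator measurableSet_Icc)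
  have hRle : ∀ n t, |R n t| ≤ |f t| := fun n t ↦ by
    by_cases ht : t ∈ K n <;> simp [R, ht]
  have hmeas : ∀ n, AEStronglyMeasurable (fun t ↦ |R n t| ^ p * ω t)
      (volume.restrict (Ioi 0)) := fun n ↦
    (((hR n).aemeasurable.abs.pow_const p).mul
      (hω.1.aemeasurable measurableSet_Ioi)).aestronglyMeasurable
  have hbound : ∀ n, ∀ᵐ t ∂volume.restrict (Ioi 0),
      ‖|R n t| ^ p * ω t‖ ≤ |f t| ^ p * ω t := fun n ↦
    (ae_restrict_iff' measurableSet_Ioi).2 <| .of_forall fun t ht ↦ by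
      have := (hω.2 t ht).le
      rw [Real.norm_of_nonneg (by positivity)]
      exact mul_le_mul_of_nonneg_right
        (Real.rpow_le_rpow (abs_nonneg _) (hRle n t) hp0.le) this
  have hlim : Tendsto (fun n ↦ ∫ t in Ioi 0, |R n t| ^ p * ω t) atTop (𝓝 0) := by
    have := tendsto_integral_of_dominated_convergence (f := fun _ ↦ (0 : ℝ)) _ hmeas hfp hbound ?_
    · simpa using this
    refine (ae_restrict_iff' measurableSet_Ioi).2 <| .of_forall fun t ht ↦ ?_
    refine tendsto_const_nhds.congr' ?_
    obtain ⟨n, hn⟩ := exists_nat_one_div_lt (mem_Ioi.1 ht)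
    obtain ⟨m, hm⟩ := exists_nat_ge t
    filter_upwards [eventually_ge_atTop n, eventually_ge_atTop m] with k hkn hkm
    have hk : t ∈ K k := by
      refine ⟨le_trans ?_ hn.le, hm.trans ?_⟩
      · gcongr
      · have : (m : ℝ) ≤ k := by exact_mod_cast hkm
        linarith
    simp [R, hk, hp0.ne']
  have hlim' := hlim.rpow_const (p := 1 / p) (Or.inr (by positivity))
  rw [Real.zero_rpow (by positivity)] at hlim'
  obtain ⟨n, hn⟩ := (hlim'.eventually_le_const hε).exists
  refine ⟨1 / ((n : ℝ) + 1), n + 1, by positivity, ?_, by simp, ?_⟩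
  · rw [div_le_one (by positivity)]; simp
  · have := eLpNorm_weighted hp hω ((memLp_weighted_iff hp hω (hR n)).2
      (hfp.mono' (hmeas n) (hbound n)))
    exact this.trans_le (ENNReal.ofReal_le_ofReal hn)

theorem memLp_indicator_Icc {p : ℝ} {ω f : ℝ → ℝ} (hp : 1 < p) (hω : IsWeight ω)
    (hf : AEStronglyMeasurable f (volume.restrict (Ioi 0)))
    (hfp : IntegrableOn (fun t ↦ |f t| ^ p * ω t) (Ioi 0)) {a b : ℝ} (ha : 0 < a) :
    MemLp ((Icc a b).indicator f) (ENNReal.ofReal p) volume := by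
  have hsub : Icc a b ⊆ Ioi 0 := fun t ht ↦ ha.trans_le ht.1
  obtain ⟨M, hM⟩ := (isCompact_Icc (a := a) (b := b)).exists_bound_of_continuousOn
    (f := fun t ↦ ω t ^ (-1 / p)) ((hω.1.rpow_const fun t ht ↦ Or.inl (hω.2 t ht).ne').mono hsub)
  rw [memLp_indicator_iff_restrict measurableSet_Icc]
  refine (((memLp_weighted_iff hp hω hf).2 hfp).mono_measure
    (Measure.restrict_mono_set _ hsub)).of_le_mul (c := M)
    (hf.mono_measure (Measure.restrict_mono_set _ hsub)) ?_
  refine (ae_restrict_iff' measurableSet_Icc).2 <| .of_forall fun t ht ↦ ?_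
  have h := hω.2 t (hsub ht)
  have : f t = ω t ^ (-1 / p) * weighted p ω f t := by
    rw [weighted, mul_left_comm, ← Real.rpow_add h]
    ring_nf; simp
  rw [this, norm_mul]
  gcongr
  exact hM t ht

theorem rpow_conj_rpow_mul {p x : ℝ} (hp : 1 < p) (hx : 0 < x) :
    |x ^ (-1 / (p - 1))| ^ p * x = x ^ (-1 / (p - 1)) := by
  have hp1 : p - 1 ≠ 0 := by linarith
  rw [abs_of_nonneg (by positivity), ← Real.rpow_mul hx.le]
  nth_rw 2 [← Real.rpow_one x]
  rw [← Real.rpow_add hx]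
  congr 1; field_simp; ring

/-- If `ω ∉ B_p(∞)`, any prescribed integral is attained with arbitrarily small weighted norm. -/
theorem exists_integral_eq_setIntegral_abs_rpow_mul_le {p : ℝ} {ω : ℝ → ℝ} (hp : 1 < p)
    (hω : IsWeight ω) (hinf : ¬ BpInf p ω) (c : ℝ) {ε : ℝ} (hε : 0 < ε) :
    ∃ T : ℝ, 1 < T ∧ ∃ w : ℝ → ℝ, MemLp w (ENNReal.ofReal p) volume ∧
      (∀ t, t ∉ Icc 1 T → w t = 0) ∧ ∫ t, w t = c ∧
      IntegrableOn (fun t ↦ |w t| ^ p * ω t) (Ioi 0) ∧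
      ∫ t in Ioi 0, |w t| ^ p * ω t ≤ ε := by
  have hp0 : 0 < p := by linarith
  set v : ℝ → ℝ := fun t ↦ ω t ^ (-1 / (p - 1)) with hv
  have hlim : Tendsto (fun V : ℝ ↦ |c| ^ p * V ^ (-(p - 1))) atTop (𝓝 0) := by
    simpa using (tendsto_rpow_neg_atTop (sub_pos.2 hp)).const_mul (|c| ^ p)
  obtain ⟨R, hR⟩ := eventually_atTop.1 (hlim.eventually_le_const hε)
  obtain ⟨n, hn⟩ : ∃ n : ℕ, max R 1 < ∫ t in (1 : ℝ)..n + 2, ‖v t‖ := by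
    by_contra! h
    refine hinf (integrableOn_Ioi_of_intervalIntegral_norm_bounded (l := atTop)
      (b := fun n : ℕ ↦ (n : ℝ) + 2) (max R 1) 1 (fun n ↦ ?_)
      (tendsto_atTop_add_const_right _ _ tendsto_natCast_atTop_atTop) (.of_forall h))
    exact (hω.integrableOn_Icc _ one_pos).mono_set Ioc_subset_Icc_self
  have hT : (1 : ℝ) < n + 2 := by linarith [n.cast_nonneg (α := ℝ)]
  set T : ℝ := n + 2
  have hsub : Icc 1 T ⊆ Ioi (0 : ℝ) := fun t ht ↦ one_pos.trans_le ht.1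
  set V := ∫ t in Icc 1 T, v t with hV
  have hVlt : max R 1 < V := by
    rw [hV, integral_Icc_eq_integral_Ioc, ← intervalIntegral.integral_of_le hT.le]
    refine hn.trans_eq (intervalIntegral.integral_congr fun t ht ↦ ?_)
    rw [uIcc_of_le hT.le] at ht
    exact Real.norm_of_nonneg (Real.rpow_nonneg (hω.2 t (hsub ht)).le _)
  have hV0 : 0 < V := one_pos.trans ((le_max_right _ _).trans_lt hVlt)
  have hvi : IntegrableOn v (Icc 1 T) := hω.integrableOn_Icc _ one_pos
  have hvc : ContinuousOn v (Icc 1 T) :=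
    (hω.1.rpow_const fun t ht ↦ Or.inl (hω.2 t ht).ne').mono hsub
  have heq : (fun t ↦ |c / V * (Icc 1 T).indicator v t| ^ p * ω t) =
      (Icc 1 T).indicator fun t ↦ |c / V| ^ p * v t := by
    ext t
    by_cases ht : t ∈ Icc 1 T
    · simp only [indicator_of_mem ht]
      rw [abs_mul, Real.mul_rpow (abs_nonneg _) (abs_nonneg _), mul_assoc,
        rpow_conj_rpow_mul hp (hω.2 t (hsub ht))]
    · simp [indicator_of_notMem ht, hp0.ne']
  have hk_int : Integrable (fun t ↦ |c / V * (Icc 1 T).indicator v t| ^ p * ω t) := by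
    rw [heq, integrable_indicator_iff measurableSet_Icc]
    exact hvi.const_mul _
  refine ⟨T, hT, fun t ↦ c / V * (Icc 1 T).indicator v t, ?_, fun t ht ↦ ?_, ?_,
    hk_int.integrableOn, ?_⟩
  · refine MemLp.const_mul ?_ _
    rw [memLp_indicator_iff_restrict measurableSet_Icc]
    obtain ⟨M, hM⟩ := isCompact_Icc.exists_bound_of_continuousOn hvc
    exact .of_bound (hvc.aestronglyMeasurable measurableSet_Icc) M
      ((ae_restrict_iff' measurableSet_Icc).2 (.of_forall hM))
  · simp [indicator_of_notMem ht]
  · rw [integral_const_mul, integral_indicator measurableSet_Icc, ← hV, div_mul_cancel₀ _ hV0.ne']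
  · rw [heq, setIntegral_indicator measurableSet_Icc, inter_eq_self_of_subset_right hsub,
      integral_const_mul, ← hV]
    refine le_of_eq_of_le ?_ (hR V ((le_max_left _ _).trans hVlt.le))
    rw [abs_div, abs_of_pos hV0, Real.div_rpow (abs_nonneg _) hV0.le, neg_sub,
      Real.rpow_sub hV0, Real.rpow_one]
    ring

/-- If `ω ∉ B_p(∞)`, derivatives of test functions are dense in `L^p(ℝ₊, ω)`. -/
theorem exists_setIntegral_abs_deriv_sub_rpow_mul_le {p : ℝ} {ω f : ℝ → ℝ} (hp : 1 < p)
    (hω : IsWeight ω) (hinf : ¬ BpInf p ω)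
    (hf : AEStronglyMeasurable f (volume.restrict (Ioi 0)))
    (hfp : IntegrableOn (fun t ↦ |f t| ^ p * ω t) (Ioi 0)) {ε : ℝ} (hε : 0 < ε) :
    ∃ φ : ℝ → ℝ, (ContDiff ℝ (⊤ : ℕ∞) φ ∧ HasCompactSupport φ ∧ tsupport φ ⊆ Ioi 0) ∧
      ∫ t in Ioi 0, |deriv φ t - f t| ^ p * ω t ≤ ε := by
  have hp0 : 0 < p := by linarith
  have hP1 : 1 ≤ ENNReal.ofReal p := by simpa using hp.le
  set η : ℝ := ε ^ (1 / p) / 3 with hη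
  have hη0 : 0 < η := by positivity
  obtain ⟨a, b, ha, ha1, hb1, hab⟩ :=
    exists_indicator_Icc_eLpNorm_weighted_sub_le hp hω hf hfp hη0
  set f₁ := (Icc a b).indicator f with hf₁
  have hf₁P : MemLp f₁ (ENNReal.ofReal p) volume := memLp_indicator_Icc hp hω hf hfp ha
  obtain ⟨T, hT, w, hwP, hw0, hwi, hwint, hwle⟩ :=
    exists_integral_eq_setIntegral_abs_rpow_mul_le hp hω hinf (∫ t, f₁ t)
      (ε := η ^ p) (by positivity)
  have hf₁0 : ∀ t, t ∉ Icc a (max b T) → f₁ t = 0 := fun t ht ↦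
    indicator_of_notMem (fun h ↦ ht ⟨h.1, h.2.trans (le_max_left _ _)⟩) _
  have hw0' : ∀ t, t ∉ Icc a (max b T) → w t = 0 := fun t ht ↦
    hw0 t fun h ↦ ht ⟨ha1.trans h.1, h.2.trans (le_max_right _ _)⟩
  have hintegrable : ∀ k : ℝ → ℝ, MemLp k (ENNReal.ofReal p) volume →
      (∀ t, t ∉ Icc a (max b T) → k t = 0) → Integrable k := fun k hk hk0 ↦
    (integrableOn_iff_integrable_of_support_subset (Function.support_subset_iff'.2 hk0)).1
      ((hk.restrict _).integrable hP1)
  obtain ⟨g, hg, hg0, hgi, hgle⟩ := exists_contDiff_eLpNorm_weighted_sub_le hp hω ha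
    (ha1.trans_lt (hT.trans_le (le_max_right b T))) (hf₁P.sub hwP)
    (fun t ht ↦ by simp [hf₁0 t ht, hw0' t ht]) hη0
  have hgi0 : ∫ t, g t = 0 := by
    rw [hgi]
    simp only [Pi.sub_apply]
    rw [integral_sub (hintegrable _ hf₁P hf₁0) (hintegrable _ hwP hw0'), hwi, sub_self]
  obtain ⟨φ, hφ, hφs, hφ0, rfl⟩ := exists_contDiff_deriv_eq (half_pos ha) hg hg0 hgi0
  refine ⟨φ, ⟨hφ, hφs, hφ0⟩, ?_⟩
  have hwm : AEStronglyMeasurable w (volume.restrict (Ioi 0)) := hwP.aestronglyMeasurable.restrict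
  have hf₁m := hf₁P.aestronglyMeasurable.restrict (s := Ioi 0)
  have hgm := hg.continuous.aestronglyMeasurable (μ := volume.restrict (Ioi 0))
  have hwle' : eLpNorm (weighted p ω w) (ENNReal.ofReal p) (volume.restrict (Ioi 0)) ≤
      ENNReal.ofReal η := by
    rw [eLpNorm_weighted hp hω ((memLp_weighted_iff hp hω hwm).2 hwint)]
    refine ENNReal.ofReal_le_ofReal ?_
    rw [one_div, Real.rpow_inv_le_iff_of_pos _ hη0.le hp0]
    · exact hwle
    · exact setIntegral_nonneg measurableSet_Ioi fun t ht ↦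
        mul_nonneg (by positivity) (hω.2 t ht).le
  have hsum : weighted p ω (deriv φ - f) = -(weighted p ω (f - f₁) + weighted p ω w +
      weighted p ω (f₁ - w - deriv φ)) := by
    simp only [weighted_sub]; ring
  have htri : eLpNorm (weighted p ω (deriv φ - f)) (ENNReal.ofReal p) (volume.restrict (Ioi 0)) ≤
      ENNReal.ofReal (ε ^ (1 / p)) := by
    rw [hsum, eLpNorm_neg]
    have hm₁ := aestronglyMeasurable_weighted (p := p) hω (hf.sub hf₁m)
    have hm₂ := aestronglyMeasurable_weighted (p := p) hω hwm
    have hm₃ := aestronglyMeasurable_weighted (p := p) hω ((hf₁m.sub hwm).sub hgm)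
    calc _ ≤ ENNReal.ofReal η + ENNReal.ofReal η + ENNReal.ofReal η :=
          (eLpNorm_add_le (hm₁.add hm₂) hm₃ hP1).trans
            (add_le_add ((eLpNorm_add_le hm₁ hm₂ hP1).trans (add_le_add hab hwle')) hgle)
      _ = _ := by
          rw [← ENNReal.ofReal_add hη0.le hη0.le, ← ENNReal.ofReal_add (by positivity) hη0.le, hη]
          congr 1; ring
  have hmem : MemLp (weighted p ω (deriv φ - f)) (ENNReal.ofReal p) (volume.restrict (Ioi 0)) :=
    ⟨aestronglyMeasurable_weighted hω (hgm.sub hf), htri.trans_lt ENNReal.ofReal_lt_top⟩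
  rw [eLpNorm_weighted hp hω hmem, ENNReal.ofReal_le_ofReal_iff (by positivity)] at htri
  refine (Real.rpow_le_rpow_iff ?_ hε.le (by positivity : 0 < 1 / p)).1 htri
  exact setIntegral_nonneg measurableSet_Ioi fun t ht ↦
    mul_nonneg (by positivity) (hω.2 t ht).le

theorem IsWeight.setIntegral_abs_sub_le {p : ℝ} {ω f φ : ℝ → ℝ} (hp : 1 < p) (hω : IsWeight ω)
    (hf : AEStronglyMeasurable f (volume.restrict (Ioi 0)))
    (hfp : IntegrableOn (fun t ↦ |f t| ^ p * ω t) (Ioi 0)) (hφ : ContDiff ℝ (⊤ : ℕ∞) φ)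
    (hφs : HasCompactSupport φ) (hφ0 : tsupport φ ⊆ Ioi 0) {s : Set ℝ} (hs : MeasurableSet s)
    (hs0 : s ⊆ Ioi 0) (hv : IntegrableOn (fun t ↦ ω t ^ (-1 / (p - 1))) s) :
    ∫ t in s, |deriv φ t - f t| ≤ (∫ t in Ioi 0, |deriv φ t - f t| ^ p * ω t) ^ (1 / p) *
      (∫ t in s, ω t ^ (-1 / (p - 1))) ^ (1 - 1 / p) := by
  have hc : Continuous (deriv φ) := hφ.continuous_deriv (by simp)
  have hφm := hc.aestronglyMeasurable (μ := volume.restrict (Ioi 0))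
  exact (integrableOn_and_setIntegral_abs_le hp hω (hφm.sub hf)
    (hω.integrableOn_abs_sub_rpow_mul hp hφm hf
      (hω.integrableOn_abs_rpow_mul_of_continuous hp hc hφs.deriv
        (tsupport_deriv_subset.trans hφ0)) hfp) hs hs0 hv).2

theorem abs_sub_setIntegral_le {p : ℝ} {ω f φ : ℝ → ℝ} (hp : 1 < p) (hω : IsWeight ω)
    (hB : Bp0 p ω) (hf : AEStronglyMeasurable f (volume.restrict (Ioi 0)))
    (hfp : IntegrableOn (fun t ↦ |f t| ^ p * ω t) (Ioi 0)) (hφ : ContDiff ℝ (⊤ : ℕ∞) φ)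
    (hφs : HasCompactSupport φ) (hφ0 : tsupport φ ⊆ Ioi 0) {t T : ℝ} (ht : 0 ≤ t) (htT : t ≤ T) :
    |φ t - ∫ s in Ioc 0 t, f s| ≤
      (∫ s in Ioi 0, |deriv φ s - f s| ^ p * ω s) ^ (1 / p) * Omega0 p ω T := by
  have hc : Continuous (deriv φ) := hφ.continuous_deriv (by simp)
  have hT0 : Ioc 0 T ⊆ Ioi (0 : ℝ) := fun s hs ↦ hs.1
  have hfi := (integrableOn_and_setIntegral_abs_le hp hω hf hfp measurableSet_Ioc hT0
    (hB.integrableOn_Ioc hω T)).1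
  have hdi : IntegrableOn (deriv φ) (Ioc 0 T) :=
    (hc.integrable_of_hasCompactSupport hφs.deriv).integrableOn
  have hsub : Ioc 0 t ⊆ Ioc 0 T := Ioc_subset_Ioc_right htT
  rw [← setIntegral_deriv_eq_of_tsupport_subset hφ hφ0 ht,
    ← integral_sub (hdi.mono_set hsub) (hfi.mono_set hsub)]
  calc _ ≤ ∫ s in Ioc 0 t, |deriv φ s - f s| := abs_integral_le_integral_abs
    _ ≤ ∫ s in Ioc 0 T, |deriv φ s - f s| :=
      setIntegral_mono_set (hdi.sub hfi).abs (.of_forall fun s ↦ abs_nonneg _)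
        hsub.eventuallyLE
    _ ≤ _ := hω.setIntegral_abs_sub_le hp hf hfp hφ hφs hφ0 measurableSet_Ioc hT0
      (hB.integrableOn_Ioc hω T)

theorem tendsto_rpow_mul_const {p : ℝ} (hp : 1 < p) {I : ℕ → ℝ} (hI : Tendsto I atTop (𝓝 0))
    (C : ℝ) : Tendsto (fun n ↦ I n ^ (1 / p) * C) atTop (𝓝 0) := by
  have hp0 : 0 < p := by linarith
  have := (hI.rpow_const (p := 1 / p) (Or.inr (by positivity))).mul_const C
  rwa [Real.zero_rpow (by positivity), zero_mul] at this

theorem MemD0.memR0 {p : ℝ} {ω u u' : ℝ → ℝ} (hp : 1 < p) (hω : IsWeight ω) (hB : Bp0 p ω)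
    (h : MemD0 p ω u u') : MemR0 p ω 0 u u' := by
  obtain ⟨hD, φ, hφ, hlim, hunif⟩ := h
  refine ⟨hD, fun t ht ↦ ⟨(integrableOn_and_setIntegral_abs_le hp hω hD.aestronglyMeasurable hD.2.2
    measurableSet_Ioc (fun s hs ↦ hs.1) (hB.integrableOn_Ioc hω t)).1, ?_⟩⟩
  have h₁ : Tendsto (fun n ↦ φ n t) atTop (𝓝 (u t)) :=
    (hunif {t} (singleton_subset_iff.2 ht) isCompact_singleton).tendsto_at rfl
  rw [zero_add]
  refine tendsto_nhds_unique h₁ (tendsto_iff_norm_sub_tendsto_zero.2 ?_)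
  exact squeeze_zero (fun _ ↦ norm_nonneg _) (fun n ↦ abs_sub_setIntegral_le hp hω hB
    hD.aestronglyMeasurable hD.2.2 (hφ n).1 (hφ n).2.1 (hφ n).2.2 ht.le le_rfl)
    (tendsto_rpow_mul_const hp hlim _)

theorem MemR0.memD0 {p : ℝ} {ω u u' : ℝ → ℝ} (hp : 1 < p) (hω : IsWeight ω) (hB : Bp0 p ω)
    (hinf : ¬ BpInf p ω) (h : MemR0 p ω 0 u u') : MemD0 p ω u u' := by
  obtain ⟨hD, hR⟩ := h
  choose φ hφ hle using fun n : ℕ ↦ exists_setIntegral_abs_deriv_sub_rpow_mul_le hp hω hinf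
    hD.aestronglyMeasurable hD.2.2 (Nat.one_div_pos_of_nat (α := ℝ) (n := n))
  have hlim : Tendsto (fun n ↦ ∫ t in Ioi 0, |deriv (φ n) t - u' t| ^ p * ω t) atTop (𝓝 0) :=
    squeeze_zero (fun n ↦ setIntegral_nonneg measurableSet_Ioi fun t ht ↦
      mul_nonneg (by positivity) (hω.2 t ht).le) hle tendsto_one_div_add_atTop_nhds_zero_nat
  refine ⟨hD, φ, hφ, hlim, fun K hK0 hK ↦ ?_⟩
  obtain ⟨T, hT⟩ := hK.bddAbove
  refine Metric.tendstoUniformlyOn_iff.2 fun ε hε ↦ ?_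
  filter_upwards [(tendsto_rpow_mul_const hp hlim (Omega0 p ω T)).eventually_lt_const hε]
    with n hn t ht
  rw [dist_comm, Real.dist_eq, (hR t (hK0 ht)).2, zero_add]
  exact (abs_sub_setIntegral_le hp hω hB hD.aestronglyMeasurable hD.2.2 (hφ n).1 (hφ n).2.1
    (hφ n).2.2 (hK0 ht).le (hT ht)).trans_lt hn

/-- If `ω ∈ B_p(0) ∩ B_p(∞)`, the primitive of `ω^{-1/(p-1)}` vanishing at `0` belongs to
`R^0_{p,ω}(0)` but not to `D_0^{1,p}(ℝ₊,ω)`. -/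
theorem exists_memR0_not_memD0 {p : ℝ} {ω : ℝ → ℝ} (hp : 1 < p) (hω : IsWeight ω)
    (hB : Bp0 p ω) (hinf : BpInf p ω) :
    ∃ u u' : ℝ → ℝ, MemD p ω u u' ∧ MemR0 p ω 0 u u' ∧ ¬ MemD0 p ω u u' := by
  set v : ℝ → ℝ := fun t ↦ ω t ^ (-1 / (p - 1)) with hv
  have hvi : IntegrableOn v (Ioi 0) := by
    rw [← Ioc_union_Ioi_eq_Ioi zero_le_one]; exact hB.union hinf
  have hvpos : ∀ t, 0 < t → 0 < v t := fun t ht ↦ Real.rpow_pos_of_pos (hω.2 t ht) _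
  have hIoc : ∀ {a b : ℝ}, 0 ≤ a → IntegrableOn v (Ioc a b) := fun ha ↦
    hvi.mono_set fun _ ht ↦ ha.trans_lt ht.1
  have hD : MemD p ω (fun t ↦ ∫ s in Ioc 0 t, v s) v := by
    refine ⟨fun a b ha _ ↦ hIoc ha.le, fun a b ha hab ↦ ?_,
      (integrableOn_congr_fun (fun t ht ↦ rpow_conj_rpow_mul hp (hω.2 t ht))
        measurableSet_Ioi).2 hvi⟩
    dsimp only
    rw [← intervalIntegral.integral_of_le ha.le,
      ← intervalIntegral.integral_of_le (ha.trans hab).le]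
    refine intervalIntegral.integral_interval_sub_left ?_ ?_
    · exact (intervalIntegrable_iff_integrableOn_Ioc_of_le (ha.trans hab).le).2 (hIoc le_rfl)
    · exact (intervalIntegrable_iff_integrableOn_Ioc_of_le ha.le).2 (hIoc le_rfl)
  refine ⟨_, v, hD, ⟨hD, fun t _ ↦ ⟨hIoc le_rfl, (zero_add _).symm⟩⟩, ?_⟩
  rintro ⟨-, φ, hφ, hlim, -⟩
  have hpos : 0 < ∫ t in Ioi 0, v t := by
    rw [setIntegral_pos_iff_support_of_nonneg_ae ((ae_restrict_iff' measurableSet_Ioi).2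
      (.of_forall fun t ht ↦ (hvpos t ht).le)) hvi,
      inter_eq_self_of_subset_right (s := Function.support v) (t := Ioi 0)
        fun t ht ↦ (hvpos t ht).ne']
    simp
  refine hpos.not_ge (ge_of_tendsto' (tendsto_rpow_mul_const hp hlim
    ((∫ t in Ioi 0, v t) ^ (1 - 1 / p))) fun n ↦ ?_)
  obtain ⟨hn, hns, hn0⟩ := hφ n
  have hdi : Integrable (deriv (φ n)) :=
    (hn.continuous_deriv (by simp)).integrable_of_hasCompactSupport hns.deriv
  have hzero : ∫ t in Ioi 0, deriv (φ n) t = 0 :=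
    (setIntegral_eq_integral_of_forall_compl_eq_zero fun t ht ↦ image_eq_zero_of_notMem_tsupport
      fun h ↦ ht (hn0 (tsupport_deriv_subset h))).trans
      (integral_deriv_eq_zero_of_hasCompactSupport hn hns)
  calc ∫ t in Ioi 0, v t = -∫ t in Ioi 0, (deriv (φ n) t - v t) := by
        rw [integral_sub hdi.integrableOn hvi, hzero]; ring
    _ ≤ |∫ t in Ioi 0, (deriv (φ n) t - v t)| := neg_le_abs _
    _ ≤ ∫ t in Ioi 0, |deriv (φ n) t - v t| := abs_integral_le_integral_abs
    _ ≤ _ := hω.setIntegral_abs_sub_le hp hD.aestronglyMeasurable hD.2.2 hn hns hn0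
      measurableSet_Ioi subset_rfl hvi

/-- for `ω ∈ B_p(0)`,
`D_0^{1,p}(ℝ₊,ω) = R^0_{p,ω}(0)` iff `ω ∉ B_p(∞)`. -/
theorem stmt11 (p : ℝ) (ω : ℝ → ℝ) (hp : 1 < p) (hω : IsWeight ω)
    (hB : Bp0 p ω) :
    (∀ u u' : ℝ → ℝ, MemD p ω u u' → (MemD0 p ω u u' ↔ MemR0 p ω 0 u u')) ↔
      ¬ BpInf p ω := by

  refine ⟨fun h hinf ↦ ?_, fun hinf u u' _ ↦
    ⟨fun h ↦ h.memR0 hp hω hB, fun h ↦ h.memD0 hp hω hB hinf⟩⟩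
  obtain ⟨u, u', hD, hR, hD0⟩ := exists_memR0_not_memD0 hp hω hB hinf
  exact hD0 ((h u u' hD).2 hR)

end
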